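/- Let w, ℓ be positive integers, w̄ ≥ w + ℓ − 1, and D an even positive integer. For a₀,…,a_D chosen independently and uniformly at random from [2^w̄], define for each even d ≤ D the function h on vectors (x₀,…,x_{d−1}) ∈ [2^w]^d by h(x₀,…,x_{d−1}) = ((Σ_{i∈[d/2]} (a_{2i}+x_{2i+1})(a_{2i+1}+x_{2i})) + a_d)[w̄−ℓ, w̄). Then h is strongly universal on the domain ⋃_{even d ≤ D} [2^w]^d: for any two distinct vectors x ∈ [2^w]^d and y ∈ [2^w]^{d'} of possibly different even lengths d, d' ≤ D, and any q,r ∈ [2^ℓ], Pr[h(x)=q ∧ h(y)=r] = 1/2^{2ℓ}. -/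

import Mathlib

/-- Extend a vector `σ : Fin n → ℕ` to a function on all of `ℕ` (zero out of range).
All indices actually used below lie in range, so this is only a notational device. -/
def extendVec (n : ℕ) (σ : Fin n → ℕ) : ℕ → ℕ :=
  fun j => if h : j < n then σ ⟨j, h⟩ else 0

/-- The prefix pair-multiply-shift hash of a vector `x` of even length `d`,
with seed sequence `a`:
`h(x₀,…,x_{d−1}) = ((Σ_{i<d/2} (a_{2i} + x_{2i+1})(a_{2i+1} + x_{2i})) + a_d)[w̄−ℓ, w̄)`. -/
def prefixPairHash (wb ℓ : ℕ) (a : ℕ → ℕ) (x : List ℕ) : ℕ :=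
  ((∑ i ∈ Finset.range (x.length / 2),
      (a (2 * i) + x.getD (2 * i + 1) 0) * (a (2 * i + 1) + x.getD (2 * i) 0))
    + a x.length) % 2 ^ wb / 2 ^ (wb - ℓ)

open Finset in
theorem pp_cond {ι R : Type} [Fintype ι] [DecidableEq ι] [Fintype R] [DecidableEq R] [Nonempty R]
    (P Q : (ι → R) → Prop) [DecidablePred P] [DecidablePred Q] (k : ι) (L : ℕ)
    (hP : ∀ a v, P (Function.update a k v) ↔ P a)
    (hQ : ∀ a, (univ.filter fun v => Q (Function.update a k v)).card * L = Fintype.card R) :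
    (univ.filter fun a => P a ∧ Q a).card * L = (univ.filter fun a => P a).card := by
  have h1 : ∑ a : ι → R, ∑ v : R, (if P a ∧ Q (Function.update a k v) then L else 0)
      = (univ.filter fun a => P a).card * Fintype.card R := by
    rw [card_filter, sum_mul]
    refine sum_congr rfl fun a _ => ?_
    by_cases h : P a
    · simp only [h, true_and, if_true, one_mul]
      rw [← hQ a, card_filter, sum_mul]
      refine sum_congr rfl fun v _ => ?_
      split_ifs <;> simp
    · simp [h]
  have h2 : ∑ a : ι → R, ∑ v : R, (if P a ∧ Q (Function.update a k v) then L else 0)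
      = (univ.filter fun a => P a ∧ Q a).card * L * Fintype.card R := by
    rw [← Fintype.sum_prod_type' (f := fun a v => (if P a ∧ Q (Function.update a k v) then L else 0))]
    have : ∑ p : (ι → R) × R, (if P p.1 ∧ Q (Function.update p.1 k p.2) then L else 0)
        = ∑ p : (ι → R) × R, (if P p.1 ∧ Q p.1 then L else 0) := by
      refine sum_bij' (fun p _ => (Function.update p.1 k p.2, p.1 k))
        (fun p _ => (Function.update p.1 k p.2, p.1 k)) ?_ ?_ ?_ ?_ ?_
      · simp
      · simp
      · simp
      · simp
      · intro p _
        simp [hP]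
    rw [this, Fintype.sum_prod_type, card_filter, sum_mul, sum_mul]
    refine sum_congr rfl fun a _ => ?_
    by_cases h : P a ∧ Q a
    · simp [h, mul_comm]
    · simp [h]
  exact Nat.eq_of_mul_eq_mul_right Fintype.card_pos (h2.symm.trans h1)

instance pp_neZero (wb : ℕ) : NeZero (2 ^ wb : ℕ) := ⟨by positivity⟩

theorem pp_top (wb ℓ r : ℕ) (hl : ℓ ≤ wb) (hr : r < 2 ^ ℓ) (z : ZMod (2 ^ wb)) :
    (z + (r : ZMod (2 ^ wb)) * 2 ^ (wb - ℓ)).val / 2 ^ (wb - ℓ) = r ↔ z.val / 2 ^ (wb - ℓ) = 0 := by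
  have hM : 2 ^ wb = 2 ^ (wb - ℓ) * 2 ^ ℓ := by rw [← pow_add]; congr 1; omega
  have e : (z + (r : ZMod (2 ^ wb)) * 2 ^ (wb - ℓ)) = ((z.val + r * 2 ^ (wb - ℓ) : ℕ) : ZMod (2 ^ wb)) := by
    simp
  have hz := ZMod.val_lt z
  rw [e, ZMod.val_natCast]
  generalize z.val = t at *
  have hK : 0 < 2 ^ (wb - ℓ) := by positivity
  generalize 2 ^ (wb - ℓ) = K at *
  generalize 2 ^ ℓ = L at *
  rw [hM] at hz ⊢
  rw [Nat.mod_mul_right_div_self, Nat.add_mul_div_right _ _ hK]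
  have : t / K < L := Nat.div_lt_of_lt_mul hz
  generalize t / K = s at *
  constructor
  · intro h
    by_cases h' : s + r < L
    · rw [Nat.mod_eq_of_lt h'] at h; omega
    · rw [Nat.mod_eq_sub_mod (by omega), Nat.mod_eq_of_lt (by omega)] at h; omega
  · rintro rfl
    rw [zero_add, Nat.mod_eq_of_lt hr]

open Finset in
theorem pp_base (wb ℓ r : ℕ) (hl : ℓ ≤ wb) (hr : r < 2 ^ ℓ) (δ e b : ZMod (2 ^ wb))
    (he : e * δ = 2 ^ (wb - ℓ)) :
    (univ.filter fun v : ZMod (2 ^ wb) => (v * δ + b).val / 2 ^ (wb - ℓ) = r).card * 2 ^ ℓ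
      = Fintype.card (ZMod (2 ^ wb)) := by
  have key : ∀ r < 2 ^ ℓ,
      (univ.filter fun v : ZMod (2 ^ wb) => (v * δ + b).val / 2 ^ (wb - ℓ) = r).card
      = (univ.filter fun v : ZMod (2 ^ wb) => (v * δ + b).val / 2 ^ (wb - ℓ) = 0).card := by
    intro r hr
    symm
    refine card_equiv (Equiv.addRight ((r : ZMod (2 ^ wb)) * e)) fun v => ?_
    simp only [mem_filter, mem_univ, true_and, Equiv.coe_addRight]
    rw [← pp_top wb ℓ r hl hr, ← he]
    ring_nf
  have hs := card_eq_sum_card_fiberwise (s := (univ : Finset (ZMod (2 ^ wb)))) (t := range (2 ^ ℓ))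
    (f := fun v => (v * δ + b).val / 2 ^ (wb - ℓ)) (by
      intro v _
      simp only [coe_range, Set.mem_Iio]
      refine Nat.div_lt_of_lt_mul ?_
      rw [← pow_add, Nat.sub_add_cancel hl]
      exact ZMod.val_lt _)
  rw [sum_congr rfl (fun r hr => key r (mem_range.1 hr))] at hs
  rw [key r hr]
  simp only [sum_const, card_range, smul_eq_mul, card_univ] at hs
  rw [hs, mul_comm]

theorem pp_delta (w ℓ wb : ℕ) (hw : 0 < w) (hwb : w + ℓ - 1 ≤ wb) (m n : ℕ)
    (hm : m < 2 ^ w) (hn : n < 2 ^ w) (hne : m ≠ n) :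
    ∃ e : ZMod (2 ^ wb), e * ((n : ZMod (2 ^ wb)) - m) = 2 ^ (wb - ℓ) := by
  set d : ℤ := (n : ℤ) - m with hd
  have hd0 : d ≠ 0 := by omega
  obtain ⟨s, hs, hs'⟩ := (Nat.dvd_prime_pow Nat.prime_two).1 (show Int.gcd d (2 ^ wb : ℕ) ∣ 2 ^ wb from
    Int.natCast_dvd_natCast.1 (Int.gcd_dvd_right _ _))
  have h1 : (2 ^ s : ℕ) ≤ d.natAbs := by
    rw [← hs']
    exact Nat.le_of_dvd (by omega) (Int.gcd_dvd_natAbs_left _ _)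
  have h2 : 2 ^ s < 2 ^ w := by omega
  have h3 : s < w := (Nat.pow_lt_pow_iff_right (by norm_num)).1 h2
  have hb := Int.gcd_eq_gcd_ab d (2 ^ wb : ℕ)
  rw [hs'] at hb
  have hc := congrArg (Int.cast : ℤ → ZMod (2 ^ wb)) hb
  rw [Int.cast_add, Int.cast_mul, Int.cast_mul, Int.cast_natCast (2 ^ wb), ZMod.natCast_self] at hc
  refine ⟨(Int.gcdA d (2 ^ wb : ℕ) : ZMod (2 ^ wb)) * 2 ^ (wb - ℓ - s), ?_⟩
  have h4 : (2 : ZMod (2 ^ wb)) ^ (wb - ℓ) = 2 ^ s * 2 ^ (wb - ℓ - s) := by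
    rw [← pow_add]; congr 1; omega
  have h5 : (d : ZMod (2 ^ wb)) = (n : ZMod (2 ^ wb)) - m := by simp [hd]
  rw [h4, ← h5]
  have h6 : (2 : ZMod (2 ^ wb)) ^ s = d * (Int.gcdA d (2 ^ wb : ℕ) : ZMod (2 ^ wb)) := by
    simpa using hc
  rw [h6]; ring

/-- extension of a seed vector to all of `ℕ` -/
def ppExt {R : Type} [Zero R] (n : ℕ) (σ : Fin n → R) : ℕ → R :=
  fun j => if h : j < n then σ ⟨j, h⟩ else 0

theorem ppExt_update {R : Type} [Zero R] (n : ℕ) (σ : Fin n → R) (k : Fin n) (v : R) :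
    ppExt n (Function.update σ k v) = Function.update (ppExt n σ) k.1 v := by
  funext j
  unfold ppExt
  by_cases h : j = k.1
  · subst h; simp
  · rw [Function.update_of_ne h]
    split_ifs with h'
    · rw [Function.update_of_ne]
      intro h2; apply h; rw [← h2]
    · rfl

/-- the pair sum -/
def ppF {R : Type} [CommRing R] (a : ℕ → R) (x : List ℕ) : R :=
  ∑ i ∈ Finset.range (x.length / 2),
      (a (2 * i) + (x.getD (2 * i + 1) 0 : ℕ)) * (a (2 * i + 1) + (x.getD (2 * i) 0 : ℕ))

theorem ppF_update {R : Type} [CommRing R] (a : ℕ → R) (x : List ℕ) (k : ℕ) (v : R)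
    (hk : x.length ≤ k) : ppF (Function.update a k v) x = ppF a x := by
  unfold ppF
  refine Finset.sum_congr rfl fun i hi => ?_
  have := Finset.mem_range.1 hi
  rw [Function.update_of_ne (by omega), Function.update_of_ne (by omega)]

theorem ppF_diff {R : Type} [CommRing R] (a : ℕ → R) (x y : List ℕ) (hl : y.length = x.length)
    (k : ℕ) (hk : k < x.length) (he : x.length % 2 = 0) (v : R) :
    ppF (Function.update a k v) y - ppF (Function.update a k v) x =
      v * ((y.getD k 0 : ℕ) - (x.getD k 0 : ℕ)) +
      (ppF a y - ppF a x - a k * ((y.getD k 0 : ℕ) - (x.getD k 0 : ℕ))) := by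
  unfold ppF
  rw [hl, ← Finset.sum_sub_distrib, ← Finset.sum_sub_distrib, ← sub_eq_iff_eq_add', ← sub_eq_zero]
  have hm : k / 2 ∈ Finset.range (x.length / 2) := Finset.mem_range.2 (by omega)
  rw [← Finset.add_sum_erase _ _ hm, ← Finset.add_sum_erase (Finset.range (x.length / 2)) _ hm]
  have : ∀ f g : ℕ → R, (∀ i ∈ (Finset.range (x.length / 2)).erase (k / 2), f i = g i) →
    ∑ i ∈ (Finset.range (x.length / 2)).erase (k / 2), f i =
    ∑ i ∈ (Finset.range (x.length / 2)).erase (k / 2), g i := fun f g h => Finset.sum_congr rfl h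
  rw [this (fun i => (Function.update a k v (2 * i) + (y.getD (2 * i + 1) 0 : ℕ)) *
      (Function.update a k v (2 * i + 1) + (y.getD (2 * i) 0 : ℕ)) -
      (Function.update a k v (2 * i) + (x.getD (2 * i + 1) 0 : ℕ)) *
      (Function.update a k v (2 * i + 1) + (x.getD (2 * i) 0 : ℕ)))
      (fun i => (a (2 * i) + (y.getD (2 * i + 1) 0 : ℕ)) *
      (a (2 * i + 1) + (y.getD (2 * i) 0 : ℕ)) -
      (a (2 * i) + (x.getD (2 * i + 1) 0 : ℕ)) *
      (a (2 * i + 1) + (x.getD (2 * i) 0 : ℕ)))]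
  · rcases Nat.even_or_odd' k with ⟨c, rfl | rfl⟩
    · rw [show 2 * c / 2 = c by omega, Function.update_self, Function.update_of_ne (by omega)]
      ring
    · rw [show (2 * c + 1) / 2 = c by omega, Function.update_self, Function.update_of_ne (by omega)]
      ring
  · intro i hi
    have := (Finset.mem_erase.1 hi).1
    rw [Function.update_of_ne (by omega), Function.update_of_ne (by omega)]

/-- hash over `ZMod` -/
def ppH (wb ℓ : ℕ) (a : ℕ → ZMod (2 ^ wb)) (x : List ℕ) : ℕ :=
  (ppF a x + a x.length).val / 2 ^ (wb - ℓ)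

theorem ppH_eq (wb ℓ n : ℕ) (a : Fin n → ℕ) (x : List ℕ) :
    prefixPairHash wb ℓ (extendVec n a) x = ppH wb ℓ (ppExt n fun i => (a i : ZMod (2 ^ wb))) x := by
  have : (ppExt n fun i => (a i : ZMod (2 ^ wb))) = fun j => ((extendVec n a j : ℕ) : ZMod (2 ^ wb)) := by
    funext j
    unfold ppExt extendVec
    split_ifs <;> simp
  rw [this]
  unfold prefixPairHash ppH ppF
  rw [← ZMod.val_natCast]
  push_cast
  rfl

open Finset in
theorem pp_count_ne (ℓ wb D : ℕ) (hl : ℓ ≤ wb) (x y : List ℕ)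
    (hyD : y.length ≤ D) (hlt : x.length < y.length)
    (q r : ℕ) (hq : q < 2 ^ ℓ) (hr : r < 2 ^ ℓ) :
    (univ.filter fun a : Fin (D + 1) → ZMod (2 ^ wb) =>
      ppH wb ℓ (ppExt _ a) x = q ∧ ppH wb ℓ (ppExt _ a) y = r).card * 2 ^ ℓ * 2 ^ ℓ
      = Fintype.card (Fin (D + 1) → ZMod (2 ^ wb)) := by
  have one : ∀ (z : List ℕ) (hz : z.length < D + 1) (t : ℕ), t < 2 ^ ℓ →
      ∀ a : Fin (D + 1) → ZMod (2 ^ wb), (univ.filter fun v =>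
        ppH wb ℓ (ppExt _ (Function.update a ⟨z.length, hz⟩ v)) z = t).card * 2 ^ ℓ
        = Fintype.card (ZMod (2 ^ wb)) := by
    intro z hz t ht a
    rw [← pp_base wb ℓ t hl ht 1 (2 ^ (wb - ℓ)) (ppF (ppExt _ a) z) (mul_one _)]
    congr 2
    ext v
    simp only [mem_filter, mem_univ, true_and]
    unfold ppH
    rw [ppExt_update, ppF_update _ _ _ _ le_rfl, Function.update_self, mul_one, add_comm]
  rw [pp_cond (fun a : Fin (D + 1) → ZMod (2 ^ wb) => ppH wb ℓ (ppExt _ a) x = q)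
    (fun a => ppH wb ℓ (ppExt _ a) y = r) ⟨y.length, by omega⟩ (2 ^ ℓ) ?_ (one y _ r hr)]
  · have := pp_cond (fun a : Fin (D + 1) → ZMod (2 ^ wb) => True)
      (fun a => ppH wb ℓ (ppExt _ a) x = q) ⟨x.length, by omega⟩ (2 ^ ℓ) (by simp) (one x _ q hq)
    simpa using this
  · intro a v
    simp only [ppH]
    rw [ppExt_update, ppF_update _ _ _ _ hlt.le, Function.update_of_ne hlt.ne]

open Finset in
theorem pp_count_eq (w ℓ wb D : ℕ) (hw : 0 < w) (hwb : w + ℓ - 1 ≤ wb) (x y : List ℕ)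
    (hxlen : x.length % 2 = 0) (hxD : x.length ≤ D) (hx : ∀ c ∈ x, c < 2 ^ w)
    (hy : ∀ c ∈ y, c < 2 ^ w) (hlen : y.length = x.length) (hxy : x ≠ y)
    (q r : ℕ) (hq : q < 2 ^ ℓ) (hr : r < 2 ^ ℓ) :
    (univ.filter fun a : Fin (D + 1) → ZMod (2 ^ wb) =>
      ppH wb ℓ (ppExt _ a) x = q ∧ ppH wb ℓ (ppExt _ a) y = r).card * 2 ^ ℓ * 2 ^ ℓ
      = Fintype.card (Fin (D + 1) → ZMod (2 ^ wb)) := by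
  have hl : ℓ ≤ wb := by omega
  obtain ⟨k, hk, hkne⟩ : ∃ k, k < x.length ∧ x.getD k 0 ≠ y.getD k 0 := by
    by_contra! h
    apply hxy
    refine List.ext_getElem hlen.symm fun i h1 h2 => ?_
    have := h i h1
    rwa [List.getD_eq_getElem _ _ h1, List.getD_eq_getElem _ _ h2] at this
  have hxk : x.getD k 0 < 2 ^ w := by
    rw [List.getD_eq_getElem _ _ hk]; exact hx _ (List.getElem_mem _)
  have hyk : y.getD k 0 < 2 ^ w := by
    rw [List.getD_eq_getElem _ _ (hlen ▸ hk)]; exact hy _ (List.getElem_mem _)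
  obtain ⟨e, he⟩ := pp_delta w ℓ wb hw hwb _ _ hxk hyk hkne
  set dd : Fin (D + 1) := ⟨x.length, by omega⟩ with hdd
  set kk : Fin (D + 1) := ⟨k, by omega⟩ with hkk
  have hself : ∀ a : Fin (D + 1) → ZMod (2 ^ wb), ppExt _ a x.length = a dd := by
    intro a; unfold ppExt; rw [dif_pos]
  let P : (Fin (D + 1) → ZMod (2 ^ wb)) → Prop := fun a => (a dd).val / 2 ^ (wb - ℓ) = q
  let Q : (Fin (D + 1) → ZMod (2 ^ wb)) → Prop := fun a =>
    (ppF (ppExt _ a) y - ppF (ppExt _ a) x + a dd).val / 2 ^ (wb - ℓ) = r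
  have hne : dd ≠ kk := by
    intro h; have := congrArg Fin.val h; simp only [hdd, hkk] at this; omega
  have h1 : (univ.filter fun a : Fin (D + 1) → ZMod (2 ^ wb) =>
      ppH wb ℓ (ppExt _ a) x = q ∧ ppH wb ℓ (ppExt _ a) y = r).card
      = (univ.filter fun a => P a ∧ Q a).card := by
    have hu : ∀ (a : Fin (D + 1) → ZMod (2 ^ wb)) v, ppF (ppExt _ (Function.update a dd v)) x
        = ppF (ppExt _ a) x := by
      intro a v; rw [ppExt_update, ppF_update _ _ _ _ le_rfl]
    have hu' : ∀ (a : Fin (D + 1) → ZMod (2 ^ wb)) v, ppF (ppExt _ (Function.update a dd v)) y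
        = ppF (ppExt _ a) y := by
      intro a v; rw [ppExt_update, ppF_update _ _ _ _ hlen.le]
    refine card_bij' (fun a _ => Function.update a dd (ppF (ppExt _ a) x + a dd))
      (fun a _ => Function.update a dd (a dd - ppF (ppExt _ a) x)) ?_ ?_ ?_ ?_
    · intro a ha
      simp only [mem_filter, mem_univ, true_and, ppH, P, Q, hlen, hself] at ha ⊢
      rw [hu, hu', Function.update_self]
      refine ⟨ha.1, ?_⟩
      rw [← ha.2]; congr 2; ring
    · intro a ha
      simp only [mem_filter, mem_univ, true_and, ppH, P, Q, hlen, hself] at ha ⊢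
      rw [hu, hu', Function.update_self]
      refine ⟨?_, ?_⟩
      · rw [← ha.1]; congr 2; ring
      · rw [← ha.2]; congr 2; ring
    · intro a _
      simp [hu]
    · intro a _
      simp [hu]
  rw [h1, pp_cond P Q kk (2 ^ ℓ) ?_ ?_]
  · have := pp_cond (fun a : Fin (D + 1) → ZMod (2 ^ wb) => True) P dd (2 ^ ℓ) (by simp) (by
      intro a
      rw [← pp_base wb ℓ q hl hq 1 (2 ^ (wb - ℓ)) 0 (mul_one _)]
      simp [P])
    simpa using this
  · intro a v
    simp only [P]
    rw [Function.update_of_ne hne]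
  · intro a
    rw [← pp_base wb ℓ r hl hr _ e (ppF (ppExt _ a) y - ppF (ppExt _ a) x -
      ppExt _ a k * ((y.getD k 0 : ℕ) - (x.getD k 0 : ℕ)) + a dd) he]
    congr 2
    ext v
    simp only [mem_filter, mem_univ, true_and, Q]
    rw [ppExt_update, ppF_diff _ x y hlen k hk hxlen, Function.update_of_ne hne, add_assoc]

/-- Prefix pair-multiply-shift: let `w̄ ≥ w + ℓ − 1` and `D` be even
and positive, and draw seeds `a₀,…,a_D` independently and uniformly from `[2^w̄]`.
The resulting hash function on the domain of all vectors over `[2^w]` of even length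
at most `D` is strongly universal: for any two distinct such vectors `x, y` (possibly
of different lengths) and any `q, r ∈ [2^ℓ]`, `Pr[h(x) = q ∧ h(y) = r] = 1/2^(2ℓ)`. -/
theorem prefix_pair_multiply_shift_strongly_universal (w ℓ wb D : ℕ)
    (hw : 0 < w) (hℓ : 0 < ℓ) (hD : 0 < D) (hDeven : D % 2 = 0) (hwb : w + ℓ - 1 ≤ wb)
    (x y : List ℕ)
    (hxlen : x.length % 2 = 0) (hxD : x.length ≤ D) (hx : ∀ c ∈ x, c < 2 ^ w)
    (hylen : y.length % 2 = 0) (hyD : y.length ≤ D) (hy : ∀ c ∈ y, c < 2 ^ w)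
    (hxy : x ≠ y)
    (q r : ℕ) (hq : q < 2 ^ ℓ) (hr : r < 2 ^ ℓ) :
    (((Fintype.piFinset fun _ : Fin (D + 1) => Finset.range (2 ^ wb)).filter
        (fun a => prefixPairHash wb ℓ (extendVec (D + 1) a) x = q ∧
                  prefixPairHash wb ℓ (extendVec (D + 1) a) y = r)).card : ℚ)
      / ((Fintype.piFinset fun _ : Fin (D + 1) => Finset.range (2 ^ wb)).card : ℚ)
      = 1 / 2 ^ (2 * ℓ) := by
  have hl : ℓ ≤ wb := by omega
  have hcount : ((Fintype.piFinset fun _ : Fin (D + 1) => Finset.range (2 ^ wb)).filter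
        (fun a => prefixPairHash wb ℓ (extendVec (D + 1) a) x = q ∧
                  prefixPairHash wb ℓ (extendVec (D + 1) a) y = r)).card =
      (Finset.univ.filter fun a : Fin (D + 1) → ZMod (2 ^ wb) =>
      ppH wb ℓ (ppExt _ a) x = q ∧ ppH wb ℓ (ppExt _ a) y = r).card := by
    refine Finset.card_bij' (fun a _ i => (a i : ZMod (2 ^ wb))) (fun a _ i => (a i).val) ?_ ?_ ?_ ?_
    · intro a ha
      simpa [ppH_eq] using (Finset.mem_filter.1 ha).2
    · intro a ha
      have := (Finset.mem_filter.1 ha).2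
      simp [ppH_eq, this, ZMod.val_lt]
    · intro a ha
      have := Fintype.mem_piFinset.1 (Finset.mem_filter.1 ha).1
      funext i
      exact ZMod.val_cast_of_lt (Finset.mem_range.1 (this i))
    · intro a ha
      funext i
      simp
  have main : (Finset.univ.filter fun a : Fin (D + 1) → ZMod (2 ^ wb) =>
      ppH wb ℓ (ppExt _ a) x = q ∧ ppH wb ℓ (ppExt _ a) y = r).card * 2 ^ ℓ * 2 ^ ℓ
      = Fintype.card (Fin (D + 1) → ZMod (2 ^ wb)) := by
    rcases lt_trichotomy x.length y.length with h | h | h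
    · exact pp_count_ne ℓ wb D hl x y hyD h q r hq hr
    · exact pp_count_eq w ℓ wb D hw hwb x y hxlen hxD hx hy h.symm hxy q r hq hr
    · simp_rw [and_comm (a := ppH wb ℓ _ x = q)]
      exact pp_count_ne ℓ wb D hl y x hxD h r q hr hq
  have htot : (Fintype.piFinset fun _ : Fin (D + 1) => Finset.range (2 ^ wb)).card
      = Fintype.card (Fin (D + 1) → ZMod (2 ^ wb)) := by
    simp [ZMod.card]
  have hpos : 0 < Fintype.card (Fin (D + 1) → ZMod (2 ^ wb)) := Fintype.card_pos
  rw [hcount, htot, div_eq_div_iff (by exact_mod_cast hpos.ne') (by positivity), one_mul, ← main]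
  push_cast
  ring
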